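/- arXiv:2410.00794 — 3 statements merged into one kernel-verified Lean document; each statement's English description precedes it below -/
import Mathlib

section
/- Let A be a unital C*-algebra and let a ∈ A be selfadjoint. For every s ∈ ℝ the element a² + (1+s²)·1 is invertible in A, the function s ↦ a·(a² + (1+s²)·1)⁻¹ is Bochner integrable on [0,∞) with respect to the norm of A, and (2/π) · ∫₀^∞ a·(a² + (1+s²)·1)⁻¹ ds equals the element obtained from a by the continuous functional calculus applied to the function λ ↦ λ·(1+λ²)^{−1/2}. -/
open MeasureTheory

lemma setIntegral_Ici_mul_inv_sq_add_one_add_sq (l : ℝ) :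
    ∫ s in Set.Ici (0 : ℝ), l * (l ^ 2 + (1 + s ^ 2))⁻¹ =
      Real.pi / 2 * (l * (Real.sqrt (1 + l ^ 2))⁻¹) := by
  set c := Real.sqrt (1 + l ^ 2)
  have hc_pos : 0 < c := Real.sqrt_pos.2 (by positivity)
  have hc_sq : c ^ 2 = 1 + l ^ 2 := Real.sq_sqrt (by positivity)
  have h_scale (s : ℝ) :
      l * (l ^ 2 + (1 + s ^ 2))⁻¹ = l * (c ^ 2)⁻¹ * (1 + (c⁻¹ * s) ^ 2)⁻¹ := by
    have h_eq : l ^ 2 + (1 + s ^ 2) = c ^ 2 * (1 + (c⁻¹ * s) ^ 2) := by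
      field_simp
      linarith
    rw [h_eq, mul_inv, mul_assoc]
  simp_rw [h_scale]
  rw [integral_Ici_eq_integral_Ioi, integral_const_mul,
    integral_comp_mul_left_Ioi (fun x : ℝ => (1 + x ^ 2)⁻¹) 0 (inv_pos.2 hc_pos),
    integral_Ioi_inv_one_add_sq]
  simp only [mul_zero, Real.arctan_zero, sub_zero, inv_inv, smul_eq_mul]
  field_simp

section CStarAlgebra

variable {A : Type*} [CStarAlgebra A] {a : A}

lemma IsSelfAdjoint.cfc_sq_add_one_add_sq (ha : IsSelfAdjoint a) (s : ℝ) :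
    cfc (fun l : ℝ => l ^ 2 + (1 + s ^ 2)) a = a ^ 2 + (1 + s ^ 2) • (1 : A) := by
  rw [cfc_add_const .., cfc_pow_id (R := ℝ) a 2, Algebra.algebraMap_eq_smul_one]

lemma IsSelfAdjoint.isUnit_sq_add_one_add_sq (ha : IsSelfAdjoint a) (s : ℝ) :
    IsUnit (a ^ 2 + (1 + s ^ 2) • (1 : A)) := by
  rw [← ha.cfc_sq_add_one_add_sq s, isUnit_cfc_iff (fun l : ℝ => l ^ 2 + (1 + s ^ 2)) a]
  intro l _
  positivity

lemma IsSelfAdjoint.cfc_mul_inv_sq_add_one_add_sq (ha : IsSelfAdjoint a) (s : ℝ) :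
    cfc (fun l : ℝ => l * (l ^ 2 + (1 + s ^ 2))⁻¹) a =
      a * Ring.inverse (a ^ 2 + (1 + s ^ 2) • (1 : A)) := by
  have h_ne (l : ℝ) : l ^ 2 + (1 + s ^ 2) ≠ 0 := by positivity
  have h_cont : Continuous fun l : ℝ => (l ^ 2 + (1 + s ^ 2))⁻¹ :=
    Continuous.inv₀ (by fun_prop) h_ne
  rw [cfc_mul (fun l : ℝ => l) _ a (by fun_prop) h_cont.continuousOn, cfc_id' ℝ a,
    cfc_inv (fun l : ℝ => l ^ 2 + (1 + s ^ 2)) a (fun l _ => h_ne l),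
    ha.cfc_sq_add_one_add_sq s]

end CStarAlgebra

/-- for a selfadjoint element `a` of a unital C*-algebra, `a² + (1+s²)·1`
is invertible for all `s`, the function `s ↦ a * (a² + (1+s²)·1)⁻¹` is Bochner integrable
on `[0, ∞)`, and `(2/π) ∫₀^∞ a * (a² + (1+s²)·1)⁻¹ ds = a (1+a²)^{-1/2}` (the latter via
continuous functional calculus applied to `λ ↦ λ (1+λ²)^{-1/2}`). -/
theorem kervaire_stmt10 {A : Type*} [CStarAlgebra A] (a : A) (ha : IsSelfAdjoint a) :
    (∀ s : ℝ, IsUnit (a ^ 2 + (1 + s ^ 2) • (1 : A))) ∧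
    IntegrableOn (fun s : ℝ => a * Ring.inverse (a ^ 2 + (1 + s ^ 2) • (1 : A)))
      (Set.Ici 0) ∧
    (2 / Real.pi) • (∫ s in Set.Ici (0 : ℝ),
        a * Ring.inverse (a ^ 2 + (1 + s ^ 2) • (1 : A))) =
      cfc (fun l : ℝ => l * (Real.sqrt (1 + l ^ 2))⁻¹) a := by
  simp_rw [← ha.cfc_mul_inv_sq_add_one_add_sq]
  have h_cont : Continuous (Function.uncurry fun s l : ℝ => l * (l ^ 2 + (1 + s ^ 2))⁻¹) :=
    continuous_snd.mul (Continuous.inv₀ (by fun_prop) fun p => by positivity)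
  have h_bound : ∀ᵐ s ∂(volume.restrict (Set.Ici (0 : ℝ))), ∀ l ∈ spectrum ℝ a,
      ‖l * (l ^ 2 + (1 + s ^ 2))⁻¹‖ ≤ ‖a‖ * ‖(1 : A)‖ * (1 + s ^ 2)⁻¹ := by
    refine .of_forall fun s l hl => ?_
    rw [norm_mul, norm_inv, Real.norm_of_nonneg (by positivity : 0 ≤ l ^ 2 + (1 + s ^ 2))]
    exact mul_le_mul (spectrum.norm_le_norm_mul_of_mem hl)
      (inv_anti₀ (by positivity) (le_add_of_nonneg_left (sq_nonneg l)))
      (by positivity) (by positivity)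
  have h_int : HasFiniteIntegral (fun s : ℝ => ‖a‖ * ‖(1 : A)‖ * (1 + s ^ 2)⁻¹)
      (volume.restrict (Set.Ici 0)) :=
    (integrable_inv_one_add_sq.const_mul _).integrableOn.hasFiniteIntegral
  refine ⟨ha.isUnit_sq_add_one_add_sq,
    integrableOn_cfc measurableSet_Ici _ _ a h_cont.continuousOn h_bound h_int, ?_⟩
  rw [← cfc_setIntegral measurableSet_Ici _ _ a h_cont.continuousOn h_bound h_int]
  simp_rw [setIntegral_Ici_mul_inv_sq_add_one_add_sq]
  have h_sqrt : Continuous fun l : ℝ => l * (Real.sqrt (1 + l ^ 2))⁻¹ :=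
    continuous_id.mul
      (Continuous.inv₀ (by fun_prop) fun l => (Real.sqrt_pos.2 (by positivity)).ne')
  rw [cfc_const_mul _ _ a h_sqrt.continuousOn, smul_smul, div_mul_div_cancel₀' two_ne_zero,
    div_self Real.pi_ne_zero, one_smul]
end

section
/- Let A be a unital C*-algebra, let a, k ∈ A be selfadjoint, and set b = a + k. Let F denote the application of the continuous functional calculus with the function λ ↦ λ·(1+λ²)^{−1/2} to a selfadjoint element. Then F(a) − F(b) = (2/π) · ∫₀^∞ (a² + (1+s²)·1)⁻¹ · (a·k·b − (1+s²)·k) · (b² + (1+s²)·1)⁻¹ ds, where the integral is norm (Bochner) convergent on [0,∞). -/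
open MeasureTheory

theorem integral_Ici_inv_sq_add_one_add_sq (l : ℝ) :
    ∫ s in Set.Ici (0 : ℝ), (l ^ 2 + (1 + s ^ 2))⁻¹ = Real.pi / 2 * (Real.sqrt (1 + l ^ 2))⁻¹ := by
  have hc : 0 < Real.sqrt (1 + l ^ 2) := by positivity
  have hc2 : Real.sqrt (1 + l ^ 2) ^ 2 = 1 + l ^ 2 := Real.sq_sqrt (by positivity)
  set c := Real.sqrt (1 + l ^ 2)
  have h : ∀ s : ℝ, (l ^ 2 + (1 + s ^ 2))⁻¹ = (c ^ 2)⁻¹ * (1 + (c⁻¹ * s) ^ 2)⁻¹ := by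
    intro s
    rw [← mul_inv]
    congr 1
    field_simp
    linarith
  simp_rw [h]
  rw [integral_Ici_eq_integral_Ioi, integral_const_mul,
    integral_comp_mul_left_Ioi (fun x : ℝ => (1 + x ^ 2)⁻¹) 0 (inv_pos.mpr hc)]
  simp
  field_simp

section CStarAlgebra

variable {A : Type*} [CStarAlgebra A] {a : A}

theorem IsSelfAdjoint.sq_add_smul_one_eq_cfc (ha : IsSelfAdjoint a) (t : ℝ) :
    a ^ 2 + t • (1 : A) = cfc (fun l : ℝ => l ^ 2 + t) a := by
  rw [cfc_add_const t (fun l : ℝ => l ^ 2) a, cfc_pow_id (R := ℝ) a 2,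
    Algebra.algebraMap_eq_smul_one]

theorem IsSelfAdjoint.isUnit_sq_add_smul_one (ha : IsSelfAdjoint a) {t : ℝ} (ht : 0 < t) :
    IsUnit (a ^ 2 + t • (1 : A)) := by
  rw [ha.sq_add_smul_one_eq_cfc]
  exact (isUnit_cfc_iff (fun l : ℝ => l ^ 2 + t) a).mpr fun l _ => by positivity

theorem IsSelfAdjoint.cfc_mul_inv_sq_add (ha : IsSelfAdjoint a) {t : ℝ} (ht : 0 < t) :
    cfc (fun l : ℝ => l * (l ^ 2 + t)⁻¹) a = a * Ring.inverse (a ^ 2 + t • (1 : A)) := by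
  have h0 : ∀ l : ℝ, l ^ 2 + t ≠ 0 := fun l => by positivity
  have hc : Continuous fun l : ℝ => (l ^ 2 + t)⁻¹ := by fun_prop (disch := exact h0 _)
  rw [cfc_mul (fun l : ℝ => l) (fun l => (l ^ 2 + t)⁻¹) a continuousOn_id hc.continuousOn,
    cfc_id' ℝ a, cfc_inv (fun l : ℝ => l ^ 2 + t) a (fun l _ => h0 l),
    ha.sq_add_smul_one_eq_cfc]

theorem continuous_mul_inv_sq_add_one_add_sq :
    Continuous (Function.uncurry fun s l : ℝ => l * (l ^ 2 + (1 + s ^ 2))⁻¹) := by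
  have h0 : ∀ p : ℝ × ℝ, p.2 ^ 2 + (1 + p.1 ^ 2) ≠ 0 := fun p => by positivity
  unfold Function.uncurry
  fun_prop (disch := exact h0 _)

theorem norm_mul_inv_sq_add_one_add_sq_le {s l : ℝ} (hl : l ∈ spectrum ℝ a) :
    ‖l * (l ^ 2 + (1 + s ^ 2))⁻¹‖ ≤ ‖a‖ * ‖(1 : A)‖ * (1 + s ^ 2)⁻¹ := by
  have h : 1 + s ^ 2 ≤ l ^ 2 + (1 + s ^ 2) := le_add_of_nonneg_left (sq_nonneg l)
  rw [norm_mul, norm_inv, Real.norm_of_nonneg (by positivity : 0 ≤ l ^ 2 + (1 + s ^ 2))]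
  gcongr
  exact spectrum.norm_le_norm_mul_of_mem hl

theorem hasFiniteIntegral_const_mul_inv_one_add_sq (c : ℝ) :
    HasFiniteIntegral (fun s : ℝ => c * (1 + s ^ 2)⁻¹) (volume.restrict (Set.Ici 0)) :=
  (integrable_inv_one_add_sq.const_mul c).integrableOn.hasFiniteIntegral

theorem IsSelfAdjoint.integrableOn_mul_inverse (ha : IsSelfAdjoint a) :
    IntegrableOn (fun s : ℝ => a * Ring.inverse (a ^ 2 + (1 + s ^ 2) • (1 : A))) (Set.Ici 0) := by
  have h := integrableOn_cfc (μ := volume) measurableSet_Ici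
    (fun s l : ℝ => l * (l ^ 2 + (1 + s ^ 2))⁻¹) _ a
    continuous_mul_inv_sq_add_one_add_sq.continuousOn
    (.of_forall fun s l hl => norm_mul_inv_sq_add_one_add_sq_le hl)
    (hasFiniteIntegral_const_mul_inv_one_add_sq _) ha
  exact h.congr_fun (fun s _ => ha.cfc_mul_inv_sq_add (by positivity)) measurableSet_Ici

theorem IsSelfAdjoint.cfc_mul_inv_sqrt_eq_integral (ha : IsSelfAdjoint a) :
    cfc (fun l : ℝ => l * (Real.sqrt (1 + l ^ 2))⁻¹) a =
      (2 / Real.pi) • ∫ s in Set.Ici (0 : ℝ),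
        a * Ring.inverse (a ^ 2 + (1 + s ^ 2) • (1 : A)) := by
  have h := cfc_setIntegral (μ := volume) measurableSet_Ici
    (fun s l : ℝ => l * (l ^ 2 + (1 + s ^ 2))⁻¹) _ a
    continuous_mul_inv_sq_add_one_add_sq.continuousOn
    (.of_forall fun s l hl => norm_mul_inv_sq_add_one_add_sq_le hl)
    (hasFiniteIntegral_const_mul_inv_one_add_sq _) ha
  have hs (s : ℝ) := ha.cfc_mul_inv_sq_add (by positivity : 0 < 1 + s ^ 2)
  simp_rw [hs, integral_const_mul,
    integral_Ici_inv_sq_add_one_add_sq] at h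
  have h0 : ∀ l : ℝ, Real.sqrt (1 + l ^ 2) ≠ 0 := fun l => by positivity
  have hc : Continuous fun l : ℝ => l * (Real.pi / 2 * (Real.sqrt (1 + l ^ 2))⁻¹) := by
    fun_prop (disch := exact h0 _)
  rw [← h, ← cfc_smul (2 / Real.pi) _ a hc.continuousOn]
  congr 1
  ext l
  have := Real.pi_ne_zero
  rw [smul_eq_mul]
  field_simp

theorem IsSelfAdjoint.mul_inverse_sub_mul_inverse {b : A} (ha : IsSelfAdjoint a)
    (hb : IsSelfAdjoint b) {t : ℝ} (ht : 0 < t) :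
    a * Ring.inverse (a ^ 2 + t • (1 : A)) - b * Ring.inverse (b ^ 2 + t • (1 : A)) =
      Ring.inverse (a ^ 2 + t • (1 : A)) * (a * (b - a) * b - t • (b - a)) *
        Ring.inverse (b ^ 2 + t • (1 : A)) := by
  have hP := ha.isUnit_sq_add_smul_one ht
  have hQ := hb.isUnit_sq_add_smul_one ht
  have hcomm : Commute (Ring.inverse (a ^ 2 + t • (1 : A))) a := by
    have h : Commute (a ^ 2 + t • (1 : A)) a :=
      ((Commute.refl a).pow_left 2).add_left ((Commute.one_left a).smul_left t)
    obtain ⟨u, hu⟩ := hP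
    rw [← hu] at h ⊢
    rw [Ring.inverse_unit]
    exact h.units_inv_left
  have hmid : a * (b - a) * b - t • (b - a) =
      a * (b ^ 2 + t • (1 : A)) - (a ^ 2 + t • (1 : A)) * b := by
    simp only [mul_add, add_mul, mul_sub, sub_mul, smul_sub, mul_smul_comm, smul_mul_assoc,
      mul_one, one_mul, pow_two, mul_assoc]
    abel
  rw [hmid, mul_sub, sub_mul, ← mul_assoc, ← mul_assoc, Ring.mul_inverse_cancel_right _ _ hQ,
    Ring.inverse_mul_cancel _ hP, one_mul, hcomm.eq]

end CStarAlgebra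

/-- for selfadjoint `a, k` in a unital C*-algebra and `b = a + k`, with
`F x = cfc (λ ↦ λ (1+λ²)^{-1/2}) x`, one has
`F a - F b = (2/π) ∫₀^∞ (a²+(1+s²)·1)⁻¹ (a k b - (1+s²) k) (b²+(1+s²)·1)⁻¹ ds`,
the integral being norm (Bochner) convergent on `[0, ∞)`. -/
theorem kervaire_stmt12 {A : Type*} [CStarAlgebra A] (a k : A) (ha : IsSelfAdjoint a)
    (hk : IsSelfAdjoint k) (b : A) (hb : b = a + k) :
    IntegrableOn (fun s : ℝ =>
        Ring.inverse (a ^ 2 + (1 + s ^ 2) • (1 : A)) *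
          (a * k * b - (1 + s ^ 2) • k) *
          Ring.inverse (b ^ 2 + (1 + s ^ 2) • (1 : A))) (Set.Ici 0) ∧
    cfc (fun l : ℝ => l * (Real.sqrt (1 + l ^ 2))⁻¹) a -
        cfc (fun l : ℝ => l * (Real.sqrt (1 + l ^ 2))⁻¹) b =
      (2 / Real.pi) • ∫ s in Set.Ici (0 : ℝ),
        Ring.inverse (a ^ 2 + (1 + s ^ 2) • (1 : A)) *
          (a * k * b - (1 + s ^ 2) • k) *
          Ring.inverse (b ^ 2 + (1 + s ^ 2) • (1 : A)) := by
  have hbs : IsSelfAdjoint b := hb ▸ ha.add hk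
  have hk' : k = b - a := by rw [hb, add_sub_cancel_left]
  have key (s : ℝ) : Ring.inverse (a ^ 2 + (1 + s ^ 2) • (1 : A)) *
        (a * k * b - (1 + s ^ 2) • k) * Ring.inverse (b ^ 2 + (1 + s ^ 2) • (1 : A)) =
      a * Ring.inverse (a ^ 2 + (1 + s ^ 2) • (1 : A)) -
        b * Ring.inverse (b ^ 2 + (1 + s ^ 2) • (1 : A)) := by
    rw [hk', ha.mul_inverse_sub_mul_inverse hbs (by positivity)]
  simp_rw [key]
  refine ⟨ha.integrableOn_mul_inverse.sub hbs.integrableOn_mul_inverse, ?_⟩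
  rw [integral_sub ha.integrableOn_mul_inverse hbs.integrableOn_mul_inverse, smul_sub,
    ha.cfc_mul_inv_sqrt_eq_integral, hbs.cfc_mul_inv_sqrt_eq_integral]
end

section
/- Let H be a complex Hilbert space and let a, b be bounded selfadjoint operators on H such that a − b is a compact operator. Then F(a) − F(b) is a compact operator, where F denotes the continuous functional calculus with the function λ ↦ λ·(1+λ²)^{−1/2} applied to a bounded selfadjoint operator (i.e. F(a) = a·(1 + a²)^{−1/2}, with (1+a²)^{−1/2} the inverse of the positive square root of 1 + a²). -/
theorem isCompactOperator_aeval_sub_aeval {E : Type*} [NormedAddCommGroup E] [NormedSpace ℂ E]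
    {a b : E →L[ℂ] E} (hab : IsCompactOperator ((a - b : E →L[ℂ] E) : E → E))
    (p : Polynomial ℝ) :
    IsCompactOperator
      ((Polynomial.aeval a p - Polynomial.aeval b p : E →L[ℂ] E) : E → E) := by
  induction p using Polynomial.induction_on' with
  | add p q hp hq =>
    rw [map_add, map_add, add_sub_add_comm]
    exact hp.add hq
  | monomial n c =>
    rw [Polynomial.aeval_monomial, Polynomial.aeval_monomial, ← mul_sub]
    refine IsCompactOperator.clm_comp ?_ (algebraMap ℝ (E →L[ℂ] E) c)
    induction n with
    | zero =>
      rw [pow_zero, pow_zero, sub_self]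
      exact isCompactOperator_zero
    | succ n ih =>
      have h : a ^ (n + 1) - b ^ (n + 1) = (a ^ n - b ^ n) * a + b ^ n * (a - b) := by
        rw [pow_succ, pow_succ]; noncomm_ring
      rw [h]
      exact (ih.comp_clm a).add (hab.clm_comp (b ^ n))

/-- Continuous functional calculus preserves congruence modulo the compact operators. -/
theorem isCompactOperator_cfc_sub_cfc {H : Type*} [NormedAddCommGroup H]
    [InnerProductSpace ℂ H] [CompleteSpace H] {a b : H →L[ℂ] H} (ha : IsSelfAdjoint a)
    (hb : IsSelfAdjoint b) (hab : IsCompactOperator ((a - b : H →L[ℂ] H) : H → H))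
    {f : ℝ → ℝ} (hf : Continuous f) :
    IsCompactOperator ((cfc f a - cfc f b : H →L[ℂ] H) : H → H) := by
  have hK : Bornology.IsBounded (spectrum ℝ a ∪ spectrum ℝ b) :=
    (ContinuousFunctionalCalculus.isCompact_spectrum a).isBounded.union
      (ContinuousFunctionalCalculus.isCompact_spectrum b).isBounded
  obtain ⟨R, hR⟩ := hK.subset_closedBall 0
  rw [Real.closedBall_eq_Icc] at hR
  refine (isClosed_setOfPred_isCompactOperator (σ₁₂ := RingHom.id ℂ) (M₁ := H)
    (M₂ := H)).closure_subset (Metric.mem_closure_iff.2 fun ε hε => ?_)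
  obtain ⟨p, hp⟩ := exists_polynomial_near_of_continuousOn _ _ f hf.continuousOn (ε / 3)
    (by positivity)
  refine ⟨_, isCompactOperator_aeval_sub_aeval hab p, ?_⟩
  have approx : ∀ c : H →L[ℂ] H, IsSelfAdjoint c → spectrum ℝ c ⊆ Set.Icc (0 - R) (0 + R) →
      ‖cfc f c - Polynomial.aeval c p‖ ≤ ε / 3 := by
    intro c hc hs
    rw [← cfc_polynomial p c, ← cfc_sub f p.eval c hf.continuousOn p.continuous.continuousOn]
    refine norm_cfc_le (by positivity) fun x hx => ?_
    rw [Real.norm_eq_abs, abs_sub_comm]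
    exact (hp x (hs hx)).le
  have h := norm_sub_le (cfc f a - Polynomial.aeval a p) (cfc f b - Polynomial.aeval b p)
  have h₁ := approx a ha (Set.subset_union_left.trans hR)
  have h₂ := approx b hb (Set.subset_union_right.trans hR)
  rw [dist_eq_norm, sub_sub_sub_comm]
  linarith

/-- if `a, b` are bounded selfadjoint operators on a complex Hilbert space
with `a - b` compact, then `F a - F b` is compact, where
`F x = cfc (λ ↦ λ (1+λ²)^{-1/2}) x = x (1+x²)^{-1/2}`. -/
theorem kervaire_stmt13 {H : Type*} [NormedAddCommGroup H] [InnerProductSpace ℂ H]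
    [CompleteSpace H] (a b : H →L[ℂ] H) (ha : IsSelfAdjoint a) (hb : IsSelfAdjoint b)
    (hab : IsCompactOperator ((a - b : H →L[ℂ] H) : H → H)) :
    IsCompactOperator
      (((cfc (fun l : ℝ => l * (Real.sqrt (1 + l ^ 2))⁻¹) a -
          cfc (fun l : ℝ => l * (Real.sqrt (1 + l ^ 2))⁻¹) b) : H →L[ℂ] H) : H → H) := by
  refine isCompactOperator_cfc_sub_cfc ha hb hab ?_
  refine continuous_id.mul (Continuous.inv₀ (by fun_prop) fun x => ?_)
  positivity
end
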